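/- For every integer n ≥ 4, the homomorphism π : S̃_n → Equiv.Perm (Fin n) is surjective, its kernel is exactly the subgroup {1, z} generated by the central element z, and z has order 2 (in particular z ≠ 1); consequently Nat.card (S̃_n) = 2 * n!. -/

import Mathlib

/-- Relations defining the double cover `S̃ₙ` of the symmetric group:
generators are `none = z` and `some i = tᵢ` for `i : Fin (n-1)`, with relations
`z² = 1`, `tᵢ² = z`, `(tᵢ tᵢ₊₁)³ = z` and `(tᵢ tⱼ)² = z` for `|i - j| ≥ 2`. -/
def spinRels (n : ℕ) : Set (FreeGroup (Option (Fin (n - 1)))) :=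
  {r | r = FreeGroup.of (none : Option (Fin (n - 1))) ^ 2}
  ∪ {r | ∃ i : Fin (n - 1), r = FreeGroup.of (some i) ^ 2 * (FreeGroup.of none)⁻¹}
  ∪ {r | ∃ i j : Fin (n - 1), (j : ℕ) = (i : ℕ) + 1 ∧
      r = (FreeGroup.of (some i) * FreeGroup.of (some j)) ^ 3 * (FreeGroup.of none)⁻¹}
  ∪ {r | ∃ i j : Fin (n - 1), ((i : ℕ) + 2 ≤ (j : ℕ) ∨ (j : ℕ) + 2 ≤ (i : ℕ)) ∧
      r = (FreeGroup.of (some i) * FreeGroup.of (some j)) ^ 2 * (FreeGroup.of none)⁻¹}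

/-- The double cover `S̃ₙ` of the symmetric group, as a presented group. -/
abbrev SpinSym (n : ℕ) : Type := PresentedGroup (spinRels n)

/-- The central element `z` of `S̃ₙ`. -/
def spinZ (n : ℕ) : SpinSym n := PresentedGroup.of none

/-- The generator `tᵢ` of `S̃ₙ`. -/
def spinT (n : ℕ) (i : Fin (n - 1)) : SpinSym n := PresentedGroup.of (some i)

/-- The `i`-th point of `Fin n`, for `i : Fin (n-1)`. -/
def finL {n : ℕ} (i : Fin (n - 1)) : Fin n := ⟨(i : ℕ), by have := i.2; omega⟩

/-- The `(i+1)`-st point of `Fin n`, for `i : Fin (n-1)`. -/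
def finR {n : ℕ} (i : Fin (n - 1)) : Fin n := ⟨(i : ℕ) + 1, by have := i.2; omega⟩

/-- `π : S̃ₙ → Sₙ` is the canonical projection iff `π z = 1` and `π tᵢ` is the
transposition of the `i`-th and `(i+1)`-st points. -/
def IsSpinProj (n : ℕ) (π : SpinSym n →* Equiv.Perm (Fin n)) : Prop :=
  π (spinZ n) = 1 ∧ ∀ i : Fin (n - 1), π (spinT n i) = Equiv.swap (finL i) (finR i)

/-- The double cover `Ãₙ = π⁻¹(Aₙ)` of the alternating group, as a subgroup of `S̃ₙ`. -/
def SpinAlt (n : ℕ) (π : SpinSym n →* Equiv.Perm (Fin n)) : Subgroup (SpinSym n) :=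
  (alternatingGroup (Fin n)).comap π

/-- The central element `z`, as an element of `Ãₙ`. -/
def spinZA (n : ℕ) (π : SpinSym n →* Equiv.Perm (Fin n)) (hπ : IsSpinProj n π) :
    ↥(SpinAlt n π) :=
  ⟨spinZ n, Subgroup.mem_comap.mpr (by rw [hπ.1]; exact Subgroup.one_mem _)⟩

open Equiv

section BraidWords

variable {G : Type*} [Group G]

/-- The descending word `t (j + k - 1) * ⋯ * t (j + 1) * t j` of length `k`. -/
def descWord (t : ℕ → G) (j : ℕ) : ℕ → G
  | 0 => 1
  | k + 1 => t (j + k) * descWord t j k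

/-- The relations of the Coxeter presentation of `Perm (Fin n)`. -/
structure IsCoxeterTypeA (n : ℕ) (t : ℕ → G) : Prop where
  mul_self : ∀ i, i + 1 < n → t i * t i = 1
  braid : ∀ i, i + 2 < n → t i * t (i + 1) * t i = t (i + 1) * t i * t (i + 1)
  comm : ∀ i j, i + 2 ≤ j → j + 1 < n → t i * t j = t j * t i

/-- The subgroup generated by `t 0, …, t (m - 1)`. -/
def initialSubgroup (t : ℕ → G) (m : ℕ) : Subgroup G :=
  Subgroup.closure (t '' Set.Iio m)

variable {n : ℕ} {t : ℕ → G}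

lemma mem_initialSubgroup {m i : ℕ} (hi : i < m) : t i ∈ initialSubgroup t m :=
  Subgroup.subset_closure ⟨i, hi, rfl⟩

lemma descWord_succ_mul (t : ℕ → G) (j k : ℕ) :
    descWord t (j + 1) k * t j = descWord t j (k + 1) := by
  induction k with
  | zero => simp [descWord]
  | succ k ih =>
    rw [descWord, mul_assoc, ih, descWord, descWord, descWord, add_right_comm, add_assoc j k 1]

namespace IsCoxeterTypeA

variable (ht : IsCoxeterTypeA n t)
include ht

lemma descWord_mul_of_lt {i j k : ℕ} (hij : i + 2 ≤ j) (hk : j + k < n) :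
    descWord t j k * t i = t i * descWord t j k := by
  induction k with
  | zero => simp [descWord]
  | succ k ih =>
    rw [descWord, mul_assoc, ih (by omega), ← mul_assoc, ← ht.comm i (j + k) (by omega) (by omega),
      mul_assoc]

lemma descWord_mul_of_gt {i j k : ℕ} (hik : j + k + 1 ≤ i) (hi : i + 1 < n) :
    descWord t j k * t i = t i * descWord t j k := by
  induction k with
  | zero => simp [descWord]
  | succ k ih =>
    rw [descWord, mul_assoc, ih (by omega), ← mul_assoc, ht.comm (j + k) i (by omega) hi,
      mul_assoc]

lemma descWord_succ_mul_self {j k : ℕ} (hk : j + k + 1 < n) :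
    descWord t j (k + 1) * t j = descWord t (j + 1) k := by
  rw [← descWord_succ_mul, mul_assoc, ht.mul_self j (by omega), mul_one]

lemma descWord_mul_succ {i j k : ℕ} (hj : j ≤ i) (hi : i + 1 < j + k) (hk : j + k < n) :
    descWord t j k * t (i + 1) = t i * descWord t j k := by
  induction k with
  | zero => omega
  | succ k ih =>
    rcases Nat.lt_or_ge (i + 1) (j + k) with h | h
    · rw [descWord, mul_assoc, ih h (by omega), ← mul_assoc, ← ht.comm i (j + k) (by omega)
        (by omega), mul_assoc]
    · obtain ⟨l, rfl⟩ : ∃ l, k = l + 1 := ⟨k - 1, by omega⟩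
      obtain rfl : i = j + l := by omega
      rw [descWord, descWord, mul_assoc, mul_assoc, ht.descWord_mul_of_gt (by omega) (by omega),
        ← add_assoc j l 1]
      simp only [← mul_assoc]
      rw [ht.braid (j + l) (by omega)]

lemma exists_eq_mul_descWord {m : ℕ} (hm : m + 1 < n) {g : G}
    (hg : g ∈ initialSubgroup t (m + 1)) :
    ∃ h ∈ initialSubgroup t m, ∃ j k, j + k = m + 1 ∧ g = h * descWord t j k := by
  have key : ∀ x, (∃ h ∈ initialSubgroup t m, ∃ j k, j + k = m + 1 ∧ x = h * descWord t j k) →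
      ∀ i, i < m + 1 →
      ∃ h ∈ initialSubgroup t m, ∃ j k, j + k = m + 1 ∧ x * t i = h * descWord t j k := by
    rintro x ⟨h, hh, j, k, hjk, rfl⟩ i hi
    rcases lt_trichotomy i j with hij | rfl | hij
    · rcases Nat.lt_or_ge (i + 1) j with hij' | hij'
      · exact ⟨h * t i, mul_mem hh (mem_initialSubgroup (by omega)), j, k, hjk, by
          rw [mul_assoc, ht.descWord_mul_of_lt (by omega) (by omega), mul_assoc]⟩
      · obtain rfl : j = i + 1 := by omega
        exact ⟨h, hh, i, k + 1, by omega, by rw [mul_assoc, descWord_succ_mul]⟩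
    · obtain ⟨l, rfl⟩ : ∃ l, k = l + 1 := ⟨k - 1, by omega⟩
      exact ⟨h, hh, i + 1, l, by omega, by
        rw [mul_assoc, ht.descWord_succ_mul_self (by omega)]⟩
    · obtain ⟨l, rfl⟩ : ∃ l, i = l + 1 := ⟨i - 1, by omega⟩
      exact ⟨h * t l, mul_mem hh (mem_initialSubgroup (by omega)), j, k, hjk, by
        rw [mul_assoc, ht.descWord_mul_succ (by omega) (by omega) (by omega), mul_assoc]⟩
  induction hg using Subgroup.closure_induction_right with
  | one => exact ⟨1, one_mem _, m + 1, 0, rfl, by simp [descWord]⟩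
  | mul_right x _ y hy ih =>
    obtain ⟨i, hi, rfl⟩ := hy
    exact key x ih i hi
  | mul_inv_cancel x _ y hy ih =>
    obtain ⟨i, hi, rfl⟩ := hy
    rw [inv_eq_of_mul_eq_one_right (ht.mul_self i (by have : i < m + 1 := hi; omega))]
    exact key x ih i hi

omit ht

variable {f : G →* Perm (Fin n)}
  (hf : ∀ i (hi : i + 1 < n), f (t i) = swap ⟨i, by omega⟩ ⟨i + 1, hi⟩)
include hf

lemma map_descWord_apply {j k : ℕ} (hk : j + k < n) :
    f (descWord t j k) ⟨j, by omega⟩ = ⟨j + k, hk⟩ := by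
  induction k with
  | zero => simp [descWord]
  | succ k ih =>
    rw [descWord, map_mul, Perm.mul_apply, ih (by omega), hf _ (by omega), swap_apply_left]
    rfl

lemma map_apply_of_mem_initialSubgroup {m : ℕ} (hm : m + 1 < n) {h : G}
    (hh : h ∈ initialSubgroup t m) : f h ⟨m + 1, hm⟩ = ⟨m + 1, hm⟩ := by
  have : initialSubgroup t m ≤
      (MulAction.stabilizer (Perm (Fin n)) (⟨m + 1, hm⟩ : Fin n)).comap f := by
    rw [initialSubgroup, Subgroup.closure_le]
    rintro _ ⟨i, hi, rfl⟩
    have hi : i < m := hi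
    simp only [Subgroup.coe_comap, Set.mem_preimage, SetLike.mem_coe, MulAction.mem_stabilizer_iff,
      Perm.smul_def]
    rw [hf i (by omega), swap_apply_of_ne_of_ne] <;> simp only [ne_eq, Fin.mk.injEq] <;> omega
  exact this hh

include ht

lemma eq_one_of_map_eq_one {m : ℕ} (hm : m < n) {g : G} (hg : g ∈ initialSubgroup t m)
    (h1 : f g = 1) : g = 1 := by
  induction m generalizing g with
  | zero => simpa [initialSubgroup] using hg
  | succ m ih =>
    obtain ⟨h, hh, j, k, hjk, rfl⟩ := ht.exists_eq_mul_descWord hm hg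
    have hj : f (h * descWord t j k) ⟨j, by omega⟩ = ⟨m + 1, hm⟩ := by
      rw [map_mul, Perm.mul_apply, map_descWord_apply hf (by omega)]
      simp only [hjk]
      exact map_apply_of_mem_initialSubgroup hf hm hh
    rw [h1, Perm.one_apply, Fin.mk.injEq] at hj
    obtain rfl : k = 0 := by omega
    rw [descWord, mul_one] at h1 ⊢
    exact ih (by omega) hh h1

end IsCoxeterTypeA

end BraidWords

section CliffordModel

/-- The quadratic form `v ↦ -(v ⬝ᵥ v) / 2`, which takes the value `-1` on the roots `eᵢ - eⱼ`. -/
noncomputable def rootForm (n : ℕ) : QuadraticForm ℚ (Fin n → ℚ) :=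
  LinearMap.BilinMap.toQuadraticMap ((-1 / 2 : ℚ) • dotProductBilin ℚ ℚ)

/-- The root `eᵢ - eᵢ₊₁` of the root system of type `A`. -/
def simpleRoot {n : ℕ} (i : Fin (n - 1)) : Fin n → ℚ :=
  Pi.single (finL i) 1 - Pi.single (finR i) 1

lemma rootForm_apply {n : ℕ} (v : Fin n → ℚ) : rootForm n v = -1 / 2 * (v ⬝ᵥ v) := by
  simp [rootForm]

lemma polar_rootForm {n : ℕ} (v w : Fin n → ℚ) :
    QuadraticMap.polar (rootForm n) v w = -(v ⬝ᵥ w) := by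
  simp only [QuadraticMap.polar, rootForm_apply, add_dotProduct, dotProduct_add,
    dotProduct_comm w v]
  ring

lemma simpleRoot_dotProduct {n : ℕ} (i j : Fin (n - 1)) :
    simpleRoot i ⬝ᵥ simpleRoot j = (if i = j then 2 else 0)
      - (if (j : ℕ) = i + 1 then 1 else 0) - (if (i : ℕ) = j + 1 then 1 else 0) := by
  simp only [simpleRoot, sub_dotProduct, single_one_dotProduct, Pi.sub_apply, Pi.single_apply,
    finL, finR, Fin.ext_iff]
  split_ifs <;> first | omega | norm_num

/-- The image of `tᵢ` in the Clifford algebra. -/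
noncomputable def cliffordRoot {n : ℕ} (i : Fin (n - 1)) : CliffordAlgebra (rootForm n) :=
  CliffordAlgebra.ι (rootForm n) (simpleRoot i)

lemma cliffordRoot_mul_self {n : ℕ} (i : Fin (n - 1)) :
    cliffordRoot i * cliffordRoot i = -1 := by
  rw [cliffordRoot, CliffordAlgebra.ι_sq_scalar, rootForm_apply, simpleRoot_dotProduct]
  norm_num

lemma cliffordRoot_mul_add_swap {n : ℕ} (i j : Fin (n - 1)) :
    cliffordRoot i * cliffordRoot j + cliffordRoot j * cliffordRoot i =
      algebraMap ℚ _ (-(simpleRoot i ⬝ᵥ simpleRoot j)) := by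
  rw [cliffordRoot, cliffordRoot, CliffordAlgebra.ι_mul_ι_add_swap, polar_rootForm]

/-- The image of `tᵢ` as a unit of the Clifford algebra. -/
noncomputable def cliffordUnit {n : ℕ} (i : Fin (n - 1)) : (CliffordAlgebra (rootForm n))ˣ where
  val := cliffordRoot i
  inv := -cliffordRoot i
  val_inv := by rw [mul_neg, cliffordRoot_mul_self, neg_neg]
  inv_val := by rw [neg_mul, cliffordRoot_mul_self, neg_neg]

lemma mul_pow_three_eq_neg_one {A : Type*} [Ring A] {a b : A} (ha : a * a = -1) (hb : b * b = -1)
    (hab : a * b + b * a = 1) : (a * b) ^ 3 = -1 := by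
  have hsq : a * b * (a * b) = a * b - 1 := by
    calc a * b * (a * b) = a * b * (a * b + b * a) - a * (b * b) * a := by noncomm_ring
      _ = a * b - 1 := by rw [hab, hb]; simp [ha]
  rw [pow_succ, pow_two, hsq, sub_mul, hsq]
  noncomm_ring

lemma mul_pow_two_eq_neg_one {A : Type*} [Ring A] {a b : A} (ha : a * a = -1) (hb : b * b = -1)
    (hab : a * b + b * a = 0) : (a * b) ^ 2 = -1 := by
  calc (a * b) ^ 2 = a * b * (a * b + b * a) - a * (b * b) * a := by noncomm_ring
    _ = -1 := by rw [hab, hb]; simp [ha]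

/-- The action of the generators of `S̃ₙ` in the Clifford algebra. -/
noncomputable def cliffordGen (n : ℕ) : Option (Fin (n - 1)) → (CliffordAlgebra (rootForm n))ˣ
  | none => -1
  | some i => cliffordUnit i

lemma lift_cliffordGen_eq_one (n : ℕ) :
    ∀ r ∈ spinRels n, FreeGroup.lift (cliffordGen n) r = 1 := by
  rintro r (((rfl | ⟨i, rfl⟩) | ⟨i, j, hij, rfl⟩) | ⟨i, j, hij, rfl⟩)
  · simp [cliffordGen]
  all_goals
    simp only [map_mul, map_pow, map_inv, FreeGroup.lift_apply_of, cliffordGen, mul_inv_eq_one]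
    ext
    simp only [Units.val_pow_eq_pow_val, Units.val_mul, Units.val_neg, Units.val_one, cliffordUnit]
  · rw [pow_two, cliffordRoot_mul_self]
  · apply mul_pow_three_eq_neg_one (cliffordRoot_mul_self i) (cliffordRoot_mul_self j)
    rw [cliffordRoot_mul_add_swap, simpleRoot_dotProduct, if_neg (by rw [Fin.ext_iff]; omega),
      if_pos hij, if_neg (by omega)]
    norm_num
  · apply mul_pow_two_eq_neg_one (cliffordRoot_mul_self i) (cliffordRoot_mul_self j)
    rw [cliffordRoot_mul_add_swap, simpleRoot_dotProduct, if_neg (by rw [Fin.ext_iff]; omega),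
      if_neg (by omega), if_neg (by omega)]
    norm_num

lemma spinZ_ne_one (n : ℕ) : spinZ n ≠ 1 := by
  intro h
  have h' := congrArg (fun x ↦ (PresentedGroup.toGroup (lift_cliffordGen_eq_one n) x :
    (CliffordAlgebra (rootForm n))ˣ).val) h
  simp only [spinZ, PresentedGroup.toGroup.of, cliffordGen, map_one, Units.val_neg,
    Units.val_one] at h'
  have h2 : algebraMap ℚ (CliffordAlgebra (rootForm n)) 2 = 0 := by
    rw [map_ofNat, ← one_add_one_eq_two, ← eq_neg_iff_add_eq_zero]
    exact h'.symm
  have : Invertible (2 : ℚ) := invertibleOfNonzero two_ne_zero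
  exact two_ne_zero
    ((map_eq_zero_iff _ (algebraMap ℚ (CliffordAlgebra (rootForm n))).injective).1 h2)

end CliffordModel

section SpinSym

variable {n : ℕ}

lemma spinZ_sq (n : ℕ) : spinZ n ^ 2 = 1 :=
  PresentedGroup.one_of_mem (Or.inl (Or.inl (Or.inl rfl)))

lemma spinT_sq (i : Fin (n - 1)) : spinT n i ^ 2 = spinZ n :=
  PresentedGroup.mk_eq_mk_of_mul_inv_mem (Or.inl (Or.inl (Or.inr ⟨i, rfl⟩)))

lemma spinT_mul_pow_three {i j : Fin (n - 1)} (hij : (j : ℕ) = i + 1) :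
    (spinT n i * spinT n j) ^ 3 = spinZ n :=
  PresentedGroup.mk_eq_mk_of_mul_inv_mem (Or.inl (Or.inr ⟨i, j, hij, rfl⟩))

lemma spinT_mul_pow_two {i j : Fin (n - 1)} (hij : (i : ℕ) + 2 ≤ j) :
    (spinT n i * spinT n j) ^ 2 = spinZ n :=
  PresentedGroup.mk_eq_mk_of_mul_inv_mem (Or.inr ⟨i, j, Or.inl hij, rfl⟩)

lemma orderOf_spinZ (n : ℕ) : orderOf (spinZ n) = 2 :=
  orderOf_eq_prime (spinZ_sq n) (spinZ_ne_one n)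

lemma spinZ_mem_center (n : ℕ) : spinZ n ∈ Subgroup.center (SpinSym n) := by
  rw [Subgroup.mem_center_iff]
  intro g
  rw [← Subgroup.mem_centralizer_singleton_iff]
  refine PresentedGroup.generated_by (spinRels n) _ (fun x ↦ ?_) g
  rw [Subgroup.mem_centralizer_singleton_iff]
  cases x with
  | none => rfl
  | some i =>
    change spinT n i * spinZ n = spinZ n * spinT n i
    rw [← spinT_sq i]
    exact ((Commute.refl _).pow_right 2).eq

instance normal_zpowers_spinZ (n : ℕ) : (Subgroup.zpowers (spinZ n)).Normal :=
  ⟨fun x hx g ↦ by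
    rw [Subgroup.mem_center_iff.1 (Subgroup.zpowers_le.2 (spinZ_mem_center n) hx) g,
      mul_inv_cancel_right]
    exact hx⟩

/-- The images of the generators `tᵢ` in `S̃ₙ / ⟨z⟩`, extended by `1` to all of `ℕ`. -/
def spinTMod (n i : ℕ) : SpinSym n ⧸ Subgroup.zpowers (spinZ n) :=
  if h : i < n - 1 then QuotientGroup.mk (spinT n ⟨i, h⟩) else 1

lemma spinTMod_of_lt {i : ℕ} (h : i < n - 1) :
    spinTMod n i = QuotientGroup.mk (spinT n ⟨i, h⟩) := dif_pos h

lemma mk_spinZ (n : ℕ) :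
    (QuotientGroup.mk (spinZ n) : SpinSym n ⧸ Subgroup.zpowers (spinZ n)) = 1 :=
  (QuotientGroup.eq_one_iff _).2 (Subgroup.mem_zpowers _)

lemma isCoxeterTypeA_spinTMod (n : ℕ) : IsCoxeterTypeA n (spinTMod n) := by
  have hsq : ∀ i, i + 1 < n → spinTMod n i * spinTMod n i = 1 := by
    intro i hi
    rw [spinTMod_of_lt (by omega), ← pow_two, ← QuotientGroup.mk_pow, spinT_sq, mk_spinZ]
  have hinv : ∀ i, i + 1 < n → (spinTMod n i)⁻¹ = spinTMod n i := fun i hi ↦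
    inv_eq_of_mul_eq_one_right (hsq i hi)
  refine ⟨hsq, fun i hi ↦ ?_, fun i j hij hj ↦ ?_⟩
  · have h : (spinTMod n i * spinTMod n (i + 1)) ^ 3 = 1 := by
      rw [spinTMod_of_lt (by omega), spinTMod_of_lt (by omega), ← QuotientGroup.mk_mul,
        ← QuotientGroup.mk_pow, spinT_mul_pow_three rfl, mk_spinZ]
    have h' : spinTMod n i * spinTMod n (i + 1) * spinTMod n i *
        (spinTMod n (i + 1) * spinTMod n i * spinTMod n (i + 1)) = 1 := by
      rw [← h]; simp only [pow_succ, pow_zero, one_mul, mul_assoc]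
    rw [eq_inv_of_mul_eq_one_left h', mul_inv_rev, mul_inv_rev, hinv i (by omega),
      hinv (i + 1) (by omega), mul_assoc]
  · have h : (spinTMod n i * spinTMod n j) ^ 2 = 1 := by
      rw [spinTMod_of_lt (by omega), spinTMod_of_lt (by omega), ← QuotientGroup.mk_mul,
        ← QuotientGroup.mk_pow, spinT_mul_pow_two hij, mk_spinZ]
    rw [pow_two] at h
    rw [eq_inv_of_mul_eq_one_left h, mul_inv_rev, hinv i (by omega), hinv j hj]

lemma initialSubgroup_spinTMod (n : ℕ) : initialSubgroup (spinTMod n) (n - 1) = ⊤ := by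
  rw [eq_top_iff]
  rintro x -
  obtain ⟨g, rfl⟩ := QuotientGroup.mk_surjective x
  refine PresentedGroup.generated_by (spinRels n)
    ((initialSubgroup (spinTMod n) (n - 1)).comap (QuotientGroup.mk' _)) (fun x ↦ ?_) g
  cases x with
  | none =>
    change QuotientGroup.mk (spinZ n) ∈ initialSubgroup (spinTMod n) (n - 1)
    rw [mk_spinZ]
    exact one_mem _
  | some i =>
    change QuotientGroup.mk (spinT n i) ∈ initialSubgroup (spinTMod n) (n - 1)
    rw [← spinTMod_of_lt i.2]
    exact mem_initialSubgroup i.2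

namespace IsSpinProj

variable {π : SpinSym n →* Perm (Fin n)} (hπ : IsSpinProj n π)
include hπ

lemma surjective : Function.Surjective π := by
  cases n with
  | zero => exact fun σ ↦ ⟨1, Subsingleton.elim _ _⟩
  | succ n =>
    rw [← MonoidHom.mrange_eq_top, eq_top_iff, ← Perm.mclosure_swap_castSucc_succ,
      Submonoid.closure_le]
    rintro _ ⟨i, rfl⟩
    exact ⟨spinT (n + 1) i, hπ.2 i⟩

lemma zpowers_le_ker : Subgroup.zpowers (spinZ n) ≤ π.ker :=
  Subgroup.zpowers_le.2 hπ.1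

lemma ker_eq (hn : 0 < n) : π.ker = Subgroup.zpowers (spinZ n) := by
  refine le_antisymm (fun g hg ↦ ?_) hπ.zpowers_le_ker
  rw [← QuotientGroup.eq_one_iff]
  refine (isCoxeterTypeA_spinTMod n).eq_one_of_map_eq_one
    (f := QuotientGroup.lift _ π hπ.zpowers_le_ker) (m := n - 1) (fun i hi ↦ ?_) (by omega)
    (by rw [initialSubgroup_spinTMod]; trivial) hg
  rw [spinTMod_of_lt (by omega)]
  exact hπ.2 _

end IsSpinProj

end SpinSym

/-- For `n ≥ 4`, `π : S̃ₙ → Sₙ` is surjective with kernel the subgroup generated by `z`,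
`z` has order 2, and `S̃ₙ` has order `2 * n!`. -/
theorem spinSym_is_double_cover (n : ℕ) (hn : 4 ≤ n)
    (π : SpinSym n →* Equiv.Perm (Fin n)) (hπ : IsSpinProj n π) :
    Function.Surjective π ∧ π.ker = Subgroup.closure {spinZ n} ∧
      orderOf (spinZ n) = 2 ∧ Nat.card (SpinSym n) = 2 * n.factorial := by
  have hker := hπ.ker_eq (by omega)
  refine ⟨hπ.surjective, by rw [hker, Subgroup.zpowers_eq_closure], orderOf_spinZ n, ?_⟩
  rw [← π.ker.card_mul_index, Subgroup.index_ker, MonoidHom.range_eq_top.2 hπ.surjective,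
    Subgroup.card_top, Nat.card_perm, Nat.card_fin, hker, Nat.card_zpowers, orderOf_spinZ]
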